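/- Let d ≥ 1 and let C_1, …, C_n be axis-parallel boxes in ℝ^d with nonempty interior such that every two of them touch. Then n ≤ d + 1. -/

import Mathlib

/-- The closed axis-parallel box `[x 0, y 0] × ⋯ × [x (d-1), y (d-1)]` in `ℝ^d`. -/
def box (d : ℕ) (x y : Fin d → ℝ) : Set (Fin d → ℝ) :=
  Set.univ.pi fun k => Set.Icc (x k) (y k)

/-- The interior of the box: product of open intervals. -/
def boxInterior (d : ℕ) (x y : Fin d → ℝ) : Set (Fin d → ℝ) :=
  Set.univ.pi fun k => Set.Ioo (x k) (y k)

/-- Two boxes touch: their interiors are disjoint and there is a coordinate `k` in which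
their intervals meet exactly in a common endpoint, while in every other coordinate their
open intervals have a common point. -/
def BoxTouch (d : ℕ) (x₁ y₁ x₂ y₂ : Fin d → ℝ) : Prop :=
  Disjoint (boxInterior d x₁ y₁) (boxInterior d x₂ y₂) ∧
  ∃ k : Fin d, (y₁ k = x₂ k ∨ y₂ k = x₁ k) ∧
    ∀ j : Fin d, j ≠ k → (Set.Ioo (x₁ j) (y₁ j) ∩ Set.Ioo (x₂ j) (y₂ j)).Nonempty

/-- **Graham–Pollak theorem**, weighted form: if the adjacency matrix of the complete graph on `ι`
is a sum over `κ` of symmetrized rank-one matrices, then `|ι| ≤ |κ| + 1`. -/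
theorem card_le_of_sum_mul_add_mul_eq {ι κ : Type*} [Fintype ι] [Fintype κ] [DecidableEq ι]
    (a b : κ → ι → ℝ)
    (h : ∀ i j, ∑ k, (a k i * b k j + a k j * b k i) = if i = j then 0 else 1) :
    Fintype.card ι ≤ Fintype.card κ + 1 := by
  by_contra! hlt
  let M : Matrix (Option κ) ι ℝ := fun o i => o.elim 1 fun k => a k i
  have hker : LinearMap.ker M.mulVecLin ≠ ⊥ :=
    LinearMap.ker_ne_bot_of_finrank_lt (by simpa using hlt)
  obtain ⟨v, hv, hv0⟩ := (Submodule.ne_bot_iff _).1 hker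
  rw [LinearMap.mem_ker, Matrix.mulVecLin_apply] at hv
  have hsum : ∑ i, v i = 0 := by
    simpa [Matrix.mulVec, dotProduct, M] using congrFun hv none
  have ha : ∀ k, ∑ i, a k i * v i = 0 := fun k => by
    simpa [Matrix.mulVec, dotProduct, M] using congrFun hv (some k)
  have hzero : ∑ i, ∑ j, v i * v j * ∑ k, (a k i * b k j + a k j * b k i) = 0 := by
    have hk : ∀ k, ∑ i, ∑ j, v i * v j * (a k i * b k j + a k j * b k i) = 0 := fun k => calc
      _ = (∑ i, a k i * v i) * (∑ j, b k j * v j) + (∑ i, b k i * v i) * ∑ j, a k j * v j := by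
        simp only [Finset.sum_mul_sum, ← Finset.sum_add_distrib]
        exact Finset.sum_congr rfl fun i _ => Finset.sum_congr rfl fun j _ => by ring
      _ = 0 := by simp [ha]
    simp only [Finset.mul_sum]
    simp_rw [Finset.sum_comm (s := Finset.univ (α := ι)) (t := Finset.univ (α := κ))]
    exact Finset.sum_eq_zero fun k _ => hk k
  have hsq : ∑ i, v i * v i = 0 := by
    have hrow : ∀ i, ∑ j, v i * v j * (if i = j then (0 : ℝ) else 1) = -(v i * v i) := fun i => calc
      _ = ∑ j, (v i * v j - if i = j then v i * v j else 0) :=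
        Finset.sum_congr rfl fun j _ => by split_ifs <;> ring
      _ = -(v i * v i) := by simp [Finset.sum_sub_distrib, ← Finset.mul_sum, hsum]
    simp_rw [h, hrow] at hzero
    simpa using hzero
  refine hv0 (funext fun i => ?_)
  simpa using (Finset.sum_eq_zero_iff_of_nonneg fun i _ => mul_self_nonneg (v i)).1 hsq i
    (Finset.mem_univ i)

/-- Touching boxes with nonempty interior have intersecting closed intervals in each coordinate. -/
theorem BoxTouch.left_le_right {d : ℕ} {x₁ y₁ x₂ y₂ : Fin d → ℝ} (h : BoxTouch d x₁ y₁ x₂ y₂)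
    (h₁ : ∀ k, x₁ k < y₁ k) (h₂ : ∀ k, x₂ k < y₂ k) (k : Fin d) : x₁ k ≤ y₂ k := by
  obtain ⟨-, l, hl, hne⟩ := h
  obtain rfl | hkl := eq_or_ne k l
  · have := h₁ k
    have := h₂ k
    rcases hl with hl | hl <;> linarith
  · obtain ⟨z, hz₁, hz₂⟩ := hne k hkl
    exact (hz₁.1.trans hz₂.2).le

/-- Touching boxes with nonempty interior have abutting intervals in exactly one coordinate, and
there only on one side. -/
theorem BoxTouch.sum_ite_eq_one {d : ℕ} {x₁ y₁ x₂ y₂ : Fin d → ℝ} (h : BoxTouch d x₁ y₁ x₂ y₂)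
    (h₁ : ∀ k, x₁ k < y₁ k) (h₂ : ∀ k, x₂ k < y₂ k) :
    ∑ k, ((if y₁ k = x₂ k then (1 : ℝ) else 0) + if y₂ k = x₁ k then 1 else 0) = 1 := by
  obtain ⟨-, l, hl, hne⟩ := h
  rw [Finset.sum_eq_single l]
  · have := h₁ l
    have := h₂ l
    rcases hl with hl | hl
    · rw [if_pos hl, if_neg (by intro; linarith), add_zero]
    · rw [if_pos hl, if_neg (by intro; linarith), zero_add]
  · intro k _ hkl
    obtain ⟨z, hz₁, hz₂⟩ := hne k hkl
    rw [if_neg (hz₂.1.trans hz₁.2).ne', if_neg (hz₁.1.trans hz₂.2).ne', add_zero]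
  · simp

/-- **Clique bound.** If `n` axis-parallel boxes in `ℝ^d` with nonempty interior
pairwise touch, then `n ≤ d + 1`. -/
theorem pairwise_touching_boxes_card_le
    (d n : ℕ) (hd : 1 ≤ d) (x y : Fin n → Fin d → ℝ)
    (hxy : ∀ i k, x i k < y i k)
    (htouch : ∀ i j : Fin n, i ≠ j → BoxTouch d (x i) (y i) (x j) (y j)) :
    n ≤ d + 1 := by
  classical
  have hle : ∀ i j k, x i k ≤ y j k := fun i j k => by
    obtain rfl | hij := eq_or_ne i j
    · exact (hxy i k).le
    · exact (htouch i j hij).left_le_right (hxy i) (hxy j) k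
  let a : Fin d → Fin n → ℝ := fun k i => if ∃ j, y i k = x j k then 1 else 0
  let b : Fin d → Fin n → ℝ := fun k j => if ∃ i, y i k = x j k then 1 else 0
  have hab : ∀ k i j, a k i * b k j = if y i k = x j k then 1 else 0 := fun k i j => by
    have hiff : ((∃ j', y i k = x j' k) ∧ ∃ i', y i' k = x j k) ↔ y i k = x j k := by
      refine ⟨?_, fun h => ⟨⟨j, h⟩, ⟨i, h⟩⟩⟩
      rintro ⟨⟨j', hj'⟩, i', hi'⟩
      exact le_antisymm (hj'.trans_le ((hle j' i' k).trans_eq hi')) (hle j i k)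
    simp only [a, b, ite_zero_mul_ite_zero, mul_one, hiff]
  have key := card_le_of_sum_mul_add_mul_eq a b fun i j => by
    simp only [hab]
    split_ifs with hij
    · subst hij
      exact Finset.sum_eq_zero fun k _ => by simp [(hxy i k).ne']
    · exact (htouch i j hij).sum_ite_eq_one (hxy i) (hxy j)
  simpa using key
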